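/- Let 0 < c₁ < c₂, set M := √c₂ − √c₁, and let r > 3/√c₂. Then √c₁ − √c₂·cosh(M·r) + c₂·r·sinh(M·r) > 0; consequently the derivative of J(c₃) := D(c₁, c₃; r) + D(c₂, c₃; r) at the right endpoint c₃ = c₂ is strictly positive. -/

import Mathlib

/-- The hyperbolic manifold distance
`D(c₁, c₃; r) = (−√c₁ + 2·√c₃·cosh((√c₃ − √c₁)·r)) / (2·√c₁·c₃)`. -/
noncomputable def D (c₁ r c₃ : ℝ) : ℝ :=
  (-Real.sqrt c₁ + 2 * Real.sqrt c₃ * Real.cosh ((Real.sqrt c₃ - Real.sqrt c₁) * r)) /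
    (2 * Real.sqrt c₁ * c₃)

theorem hasDerivAt_D {c₁ c r : ℝ} (hc₁ : 0 < c₁) (hc : 0 < c) :
    HasDerivAt (D c₁ r)
      ((√c₁ - √c * Real.cosh ((√c - √c₁) * r) + c * r * Real.sinh ((√c - √c₁) * r)) /
        (2 * √c₁ * c ^ 2)) c := by
  have hs : HasDerivAt Real.sqrt (1 / (2 * √c)) c := Real.hasDerivAt_sqrt hc.ne'
  have ha : 0 < √c₁ := Real.sqrt_pos.2 hc₁
  have hb : 0 < √c := Real.sqrt_pos.2 hc
  have hsq : √c ^ 2 = c := Real.sq_sqrt hc.le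
  have hcosh := ((hs.sub_const (√c₁)).mul_const r).cosh
  have hnum := ((hs.const_mul 2).mul hcosh).const_add (-√c₁)
  have hden := (hasDerivAt_id c).const_mul (2 * √c₁)
  refine (hnum.div hden (by simp only [id]; positivity)).congr_deriv ?_
  simp only [id, Pi.mul_apply]
  generalize Real.cosh ((√c - √c₁) * r) = C
  generalize Real.sinh ((√c - √c₁) * r) = S
  generalize √c = b at *
  subst hsq
  field_simp
  ring

theorem sub_mul_cosh_add_mul_sinh_pos {a b r : ℝ} (hb : 0 < b) (hab : a < b) (hr : 3 < b * r) :
    0 < a - b * Real.cosh ((b - a) * r) + b ^ 2 * r * Real.sinh ((b - a) * r) := by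
  have hM : 0 < b - a := sub_pos.2 hab
  have hr₀ : 0 < r := pos_of_mul_pos_right (by linarith) hb.le
  have hx : 0 < (b - a) * r := mul_pos hM hr₀
  have hsinh : (b - a) * r ≤ Real.sinh ((b - a) * r) := Real.self_le_sinh_iff.2 hx.le
  have hcosh : Real.cosh ((b - a) * r) ≤ 1 + Real.sinh ((b - a) * r) := by
    have := Real.cosh_sub_sinh ((b - a) * r)
    have : Real.exp (-((b - a) * r)) ≤ 1 := Real.exp_le_one_iff.2 (by linarith)
    linarith
  have h₁ := mul_le_mul_of_nonneg_left hcosh hb.le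
  have h₂ := mul_le_mul_of_nonneg_left hsinh (mul_pos hb (by linarith : 0 < b * r - 1)).le
  have h₃ : 0 < (b - a) * ((b * r) * (b * r - 1) - 1) := mul_pos hM (by nlinarith)
  linarith

theorem stmt_16 (c₁ c₂ r M : ℝ) (hc₁ : 0 < c₁) (hc : c₁ < c₂)
    (hM : M = Real.sqrt c₂ - Real.sqrt c₁) (hr : r > 3 / Real.sqrt c₂) :
    Real.sqrt c₁ - Real.sqrt c₂ * Real.cosh (M * r) + c₂ * r * Real.sinh (M * r) > 0 ∧
      0 < deriv (fun c₃ => D c₁ r c₃ + D c₂ r c₃) c₂ := by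
  subst hM
  have hc₂ : 0 < c₂ := hc₁.trans hc
  have hb : 0 < √c₂ := Real.sqrt_pos.2 hc₂
  have hpos := sub_mul_cosh_add_mul_sinh_pos hb (Real.sqrt_lt_sqrt hc₁.le hc)
    ((div_lt_iff₀' hb).1 hr)
  rw [Real.sq_sqrt hc₂.le] at hpos
  refine ⟨hpos, ?_⟩
  have hderiv := (hasDerivAt_D (r := r) hc₁ hc₂).fun_add (hasDerivAt_D (r := r) hc₂ hc₂)
  rw [hderiv.deriv]
  have ha : 0 < √c₁ := Real.sqrt_pos.2 hc₁
  simpa using div_pos hpos (by positivity : 0 < 2 * √c₁ * c₂ ^ 2)
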